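/- arXiv:2602.07863 — 3 statements merged into one kernel-verified Lean document; each statement's English description precedes it below -/
import Mathlib

section
/- Fix n ≥ 3 and b ∈ ℂ*, and for 1 ≤ i ≤ n-1 let L_i = diag(I_{i-1}, [[0,b],[1/b,0]], I_{n-i-1}) ∈ GL_n(ℂ). Then the nonzero vector v ∈ ℂ^n with entries v_j = b^{n-j} satisfies L_i v = v for every 1 ≤ i ≤ n-1. Hence the span of v is a one-dimensional invariant subspace and every non-trivial complex homogeneous 2-local representation of L_n is reducible for all n ≥ 3. -/
/-- The defining relations of the triplet group `L_n`:
generators `l_1, ..., l_{n-1}` (indexed here by `Fin (n-1)`, index `i` corresponding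
to `l_{i+1}`), and relations `l_i ^ 2 = 1`, `l_i l_{i+1} l_i = l_{i+1} l_i l_{i+1}`. -/
def tripletRels (n : ℕ) : Set (FreeGroup (Fin (n - 1))) :=
  {r | (∃ i : Fin (n - 1), r = FreeGroup.of i * FreeGroup.of i) ∨
    ∃ i j : Fin (n - 1), (i : ℕ) + 1 = (j : ℕ) ∧
      r = FreeGroup.of i * FreeGroup.of j * FreeGroup.of i *
          (FreeGroup.of j * FreeGroup.of i * FreeGroup.of j)⁻¹}

/-- The triplet group `L_n`. -/
abbrev TripletGroup (n : ℕ) := PresentedGroup (tripletRels n)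

/-- The generator `l_{i+1}` of the triplet group. -/
def ell {n : ℕ} (i : Fin (n - 1)) : TripletGroup n := PresentedGroup.of i

/-- The `n x n` matrix `diag(I_i, M, I_{n-i-2})`: it agrees with the identity matrix
except in the `2 x 2` block in rows/columns `i, i+1` (0-based), where it equals `M`. -/
def locMat {R : Type*} [CommRing R] (n : ℕ) (i : ℕ)
    (M : Matrix (Fin 2) (Fin 2) R) : Matrix (Fin n) (Fin n) R :=
  Matrix.of fun a b =>
    if (a : ℕ) = i ∧ (b : ℕ) = i then M 0 0
    else if (a : ℕ) = i ∧ (b : ℕ) = i + 1 then M 0 1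
    else if (a : ℕ) = i + 1 ∧ (b : ℕ) = i then M 1 0
    else if (a : ℕ) = i + 1 ∧ (b : ℕ) = i + 1 then M 1 1
    else if (a : ℕ) = (b : ℕ) then 1 else 0

theorem locMat_mulVec_apply {R : Type*} [CommRing R] {n i : ℕ} (M : Matrix (Fin 2) (Fin 2) R)
    (p q : Fin n) (hp : (p : ℕ) = i) (hq : (q : ℕ) = i + 1) (u : Fin n → R) (a : Fin n) :
    (locMat n i M).mulVec u a =
      if a = p then M 0 0 * u p + M 0 1 * u q
      else if a = q then M 1 0 * u p + M 1 1 * u q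
      else u a := by
  have hpq : p ≠ q := fun h => by rw [h] at hp; omega
  have key : ∀ c : Fin n, locMat n i M a c * u c =
      if a = p then (if c = p then M 0 0 * u p else 0) + (if c = q then M 0 1 * u q else 0)
      else if a = q then (if c = p then M 1 0 * u p else 0) + (if c = q then M 1 1 * u q else 0)
      else if c = a then u a else 0 := by
    intro c
    subst hp
    simp only [locMat, Matrix.of_apply, ← hq, ← Fin.ext_iff]
    split_ifs <;> grind
  simp only [Matrix.mulVec, dotProduct, key]
  split_ifs <;> simp [Finset.sum_add_distrib]

theorem locMat_one {R : Type*} [CommRing R] (n i : ℕ) :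
    locMat n i (1 : Matrix (Fin 2) (Fin 2) R) = 1 := by
  ext a c
  simp only [locMat, Matrix.of_apply, Matrix.one_apply, Fin.ext_iff]
  split_ifs <;> first | omega | simp_all

theorem locMat_antidiagonal_mulVec_pow {K : Type*} [Field K] {n i : ℕ} (hi : i + 1 < n)
    {b : K} (hb : b ≠ 0) :
    (locMat n i !![0, b; 1 / b, 0]).mulVec (fun j : Fin n => b ^ (n - 1 - (j : ℕ))) =
      fun j : Fin n => b ^ (n - 1 - (j : ℕ)) := by
  funext a
  rw [locMat_mulVec_apply _ ⟨i, by omega⟩ ⟨i + 1, hi⟩ rfl rfl]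
  have hpow : b ^ (n - 1 - i) = b * b ^ (n - 1 - (i + 1)) := by
    rw [← pow_succ']
    congr 1
    omega
  split_ifs with h1 h2
  · simp [h1, hpow]
  · simp [h2, hpow, hb]
  · rfl

theorem ell_mul_self {n : ℕ} (i : Fin (n - 1)) : ell i * ell i = 1 :=
  PresentedGroup.one_of_mem (rels := tripletRels n) (Or.inl ⟨i, rfl⟩)

theorem ell_braid {n : ℕ} (i j : Fin (n - 1)) (h : (i : ℕ) + 1 = j) :
    ell i * ell j * ell i = ell j * ell i * ell j :=
  PresentedGroup.mk_eq_mk_of_mul_inv_mem (rels := tripletRels n) (Or.inr ⟨i, j, h, rfl⟩)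

/-- A `2 × 2` block satisfying the involution and braid relations is trivial or antidiagonal. -/
theorem eq_one_or_antidiagonal_of_locMat_relations {K : Type*} [Field K] {n : ℕ}
    (hn : 3 ≤ n) (M : Matrix (Fin 2) (Fin 2) K)
    (hsq : locMat n 0 M * locMat n 0 M = 1)
    (hbr : locMat n 0 M * locMat n 1 M * locMat n 0 M =
      locMat n 1 M * locMat n 0 M * locMat n 1 M) :
    M = 1 ∨ (M 0 1 ≠ 0 ∧ M = !![0, M 0 1; 1 / M 0 1, 0]) := by
  let p : Fin n := ⟨0, by omega⟩
  let q : Fin n := ⟨1, by omega⟩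
  let r : Fin n := ⟨2, by omega⟩
  have hqp : q ≠ p := by simp [p, q]
  have hrp : r ≠ p := by simp [p, r]
  have hrq : r ≠ q := by simp [q, r]
  have h0 := locMat_mulVec_apply (i := 0) M p q rfl rfl
  have h1 := locMat_mulVec_apply (i := 1) M q r rfl rfl
  have hs : ∀ u a, (locMat n 0 M).mulVec ((locMat n 0 M).mulVec u) a = u a := fun u a => by
    rw [Matrix.mulVec_mulVec, hsq, Matrix.one_mulVec]
  have hb : ∀ u a, (locMat n 0 M).mulVec ((locMat n 1 M).mulVec ((locMat n 0 M).mulVec u)) a =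
      (locMat n 1 M).mulVec ((locMat n 0 M).mulVec ((locMat n 1 M).mulVec u)) a := fun u a => by
    simp only [Matrix.mulVec_mulVec, ← mul_assoc, hbr]
  have s00 := hs (Pi.single p 1) p
  have s11 := hs (Pi.single q 1) q
  have b00 := hb (Pi.single p 1) p
  have b01 := hb (Pi.single q 1) p
  have b10 := hb (Pi.single p 1) q
  have b22 := hb (Pi.single r 1) r
  simp only [h0, h1, Pi.single_apply, hqp, hrp, hrq, hqp.symm, hrp.symm, hrq.symm, if_true,
    if_false, mul_one, mul_zero, add_zero, zero_add] at s00 s11 b00 b01 b10 b22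
  have ha : M 0 0 = 0 ∨ M 0 0 = 1 := by grind
  have hd : M 1 1 = 0 ∨ M 1 1 = 1 := by grind
  rcases ha with ha | ha
  · right
    have hd : M 1 1 = 0 := by grind
    have hbc : M 0 1 * M 1 0 = 1 := by grind
    have hne : M 0 1 ≠ 0 := left_ne_zero_of_mul_eq_one hbc
    refine ⟨hne, ?_⟩
    ext i j
    fin_cases i <;> fin_cases j <;> simp [ha, hd]
    exact eq_inv_of_mul_eq_one_right hbc
  · left
    have hd : M 1 1 = 1 := by grind
    have hb0 : M 0 1 = 0 := by grind
    have hc0 : M 1 0 = 0 := by grind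
    ext i j
    fin_cases i <;> fin_cases j <;> simp [ha, hd, hb0, hc0]

theorem PresentedGroup.mulVec_eq_of_generators {α R m : Type*} [CommRing R] [Fintype m]
    [DecidableEq m] {rels : Set (FreeGroup α)}
    (ρ : PresentedGroup rels →* Matrix.GeneralLinearGroup m R) (v : m → R)
    (h : ∀ x, (Units.val (ρ (PresentedGroup.of x))).mulVec v = v) (g : PresentedGroup rels) :
    (Units.val (ρ g)).mulVec v = v := by
  have hg : g ∈ Subgroup.closure (Set.range (PresentedGroup.of (rels := rels))) := by
    rw [PresentedGroup.closure_range_of]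
    trivial
  induction hg using Subgroup.closure_induction with
  | mem _ hx =>
    obtain ⟨x, rfl⟩ := hx
    exact h x
  | one => simp
  | mul x y _ _ hx hy => rw [map_mul, Units.val_mul, ← Matrix.mulVec_mulVec, hy, hx]
  | inv x _ hx =>
    conv_lhs => rw [← hx]
    rw [Matrix.mulVec_mulVec, ← Units.val_mul, ← map_mul, inv_mul_cancel]
    simp

theorem Matrix.mulVec_mem_span_singleton {R m : Type*} [CommRing R] [Fintype m]
    {A : Matrix m m R} {v u : m → R} (h : A.mulVec v = v) (hu : u ∈ Submodule.span R {v}) :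
    A.mulVec u ∈ Submodule.span R {v} := by
  obtain ⟨c, rfl⟩ := Submodule.mem_span_singleton.1 hu
  rw [Matrix.mulVec_smul, h]
  exact hu

theorem span_singleton_ne_top {K : Type*} [Field K] {n : ℕ} (hn : 2 ≤ n) (v : Fin n → K) :
    Submodule.span K {v} ≠ ⊤ := by
  intro h
  have hle := finrank_span_le_card (R := K) {v}
  rw [h, finrank_top, Module.finrank_fin_fun, Set.toFinset_singleton, Finset.card_singleton] at hle
  omega

/-- Fix `n >= 3`, `b ≠ 0`, and let
`L_i = diag(I_(i-1), [[0,b],[1/b,0]], I_(n-i-1))`. The nonzero vector `v` with entries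
`v_j = b^(n-j)` (1-based `j`) satisfies `L_i v = v` for all `i`; hence the span of `v`
is a one-dimensional invariant subspace, and every non-trivial complex homogeneous
2-local representation of `L_n` is reducible for all `n >= 3`. -/
theorem homogeneous_two_local_reducible (n : ℕ) (hn : 3 ≤ n) (b : ℂ) (hb : b ≠ 0) :
    let L : Fin (n - 1) → Matrix (Fin n) (Fin n) ℂ :=
      fun i => locMat n (i : ℕ) !![0, b; 1 / b, 0]
    let v : Fin n → ℂ := fun j => b ^ (n - 1 - (j : ℕ))
    v ≠ 0 ∧
    (∀ i : Fin (n - 1), (L i).mulVec v = v) ∧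
    Module.finrank ℂ (Submodule.span ℂ {v}) = 1 ∧
    Submodule.span ℂ {v} ≠ ⊥ ∧ Submodule.span ℂ {v} ≠ ⊤ ∧
    (∀ i : Fin (n - 1), ∀ u ∈ Submodule.span ℂ {v},
      (L i).mulVec u ∈ Submodule.span ℂ {v}) ∧
    (∀ lam : TripletGroup n →* Matrix.GeneralLinearGroup (Fin n) ℂ,
      ∀ M : Matrix (Fin 2) (Fin 2) ℂ,
        (∀ i : Fin (n - 1), Units.val (lam (ell i)) = locMat n (i : ℕ) M) →
        (∃ i : Fin (n - 1), lam (ell i) ≠ 1) →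
        ∃ U : Submodule ℂ (Fin n → ℂ), U ≠ ⊥ ∧ U ≠ ⊤ ∧
          ∀ g : TripletGroup n, ∀ u ∈ U, (Units.val (lam g)).mulVec u ∈ U) := by
  intro L v
  have hpow : ∀ c : ℂ, c ≠ 0 → (fun j : Fin n => c ^ (n - 1 - (j : ℕ))) ≠ 0 := fun c hc h =>
    pow_ne_zero _ hc (congrFun h ⟨0, by omega⟩)
  have hv : v ≠ 0 := hpow b hb
  have hL : ∀ i, (L i).mulVec v = v := fun i => locMat_antidiagonal_mulVec_pow (by omega) hb
  refine ⟨hv, hL, finrank_span_singleton hv, by simpa using hv,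
    span_singleton_ne_top (by omega) v,
    fun i u hu => Matrix.mulVec_mem_span_singleton (hL i) hu, ?_⟩
  rintro lam M hM ⟨k, hk⟩
  have hsq := congrArg (fun g => Units.val (lam g)) (ell_mul_self (⟨0, by omega⟩ : Fin (n - 1)))
  have hbr := congrArg (fun g => Units.val (lam g))
    (ell_braid (⟨0, by omega⟩ : Fin (n - 1)) ⟨1, by omega⟩ rfl)
  simp only [map_mul, map_one, Units.val_mul, Units.val_one, hM] at hsq hbr
  rcases eq_one_or_antidiagonal_of_locMat_relations hn M hsq hbr with h1 | ⟨hc, hanti⟩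
  · refine absurd (Units.ext ?_) hk
    rw [hM, h1, locMat_one, Units.val_one]
  · refine ⟨Submodule.span ℂ {fun j : Fin n => M 0 1 ^ (n - 1 - (j : ℕ))},
      by simpa using hpow _ hc, span_singleton_ne_top (by omega) _, fun g u hu =>
        Matrix.mulVec_mem_span_singleton
          (PresentedGroup.mulVec_eq_of_generators lam _ (fun i => ?_) g) hu⟩
    have hgen := locMat_antidiagonal_mulVec_pow (n := n) (i := i) (by omega) hc
    rw [← hanti, ← hM i] at hgen
    exact hgen
end

section
/- Fix n ≥ 3 and b, x ∈ ℂ*. For 1 ≤ i ≤ n-1 set L_i = diag(I_{i-1}, [[0,b],[1/b,0]], I_{n-i-1}) and R_i = diag(I_{i-1}, [[0,x],[1/x,0]], I_{n-i-1}) in GL_n(ℂ). Then the welded relation holds for these matrices: R_i L_{i+1} L_i = L_{i+1} L_i R_{i+1} for all 1 ≤ i ≤ n-2 (so ω₁ induces a representation of WL_n). In contrast, if instead L_i = I_n for all i and R_i = diag(I_{i-1}, [[0,x],[1/x,0]], I_{n-i-1}), then R_1 L_2 L_1 ≠ L_2 L_1 R_2 (so ω₂ does not induce a representation of WL_n). 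-/
theorem locMat_mul_apply {R : Type*} [CommRing R] {n i : ℕ} (hi : i + 1 < n)
    (M : Matrix (Fin 2) (Fin 2) R) (A : Matrix (Fin n) (Fin n) R) (a c : Fin n) :
    (locMat n i M * A) a c =
      if (a : ℕ) = i then
        M 0 0 * A ⟨i, Nat.lt_of_succ_lt hi⟩ c + M 0 1 * A ⟨i + 1, hi⟩ c
      else if (a : ℕ) = i + 1 then
        M 1 0 * A ⟨i, Nat.lt_of_succ_lt hi⟩ c + M 1 1 * A ⟨i + 1, hi⟩ c
      else A a c := by
  have hne : (⟨i, Nat.lt_of_succ_lt hi⟩ : Fin n) ≠ ⟨i + 1, hi⟩ := by simp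
  rw [Matrix.mul_apply]
  split_ifs with h₀ h₁
  · rw [Fintype.sum_eq_add _ _ hne]
    · simp [locMat, h₀]
    · rintro k ⟨hk, hk'⟩
      have hk₀ : (k : ℕ) ≠ i := fun h => hk (Fin.ext h)
      have hk₁ : (k : ℕ) ≠ i + 1 := fun h => hk' (Fin.ext h)
      simp [locMat, h₀, hk₀, hk₁, hk₀.symm]
  · rw [Fintype.sum_eq_add _ _ hne]
    · simp [locMat, h₁]
    · rintro k ⟨hk, hk'⟩
      have hk₀ : (k : ℕ) ≠ i := fun h => hk (Fin.ext h)
      have hk₁ : (k : ℕ) ≠ i + 1 := fun h => hk' (Fin.ext h)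
      simp [locMat, h₁, hk₀, hk₁, hk₁.symm]
  · rw [Fintype.sum_eq_single a]
    · simp [locMat, h₀, h₁]
    · intro k hk
      simp [locMat, h₀, h₁, Fin.val_ne_of_ne hk.symm]

/-- The welded relation for antidiagonal blocks holds over any commutative ring. -/
theorem locMat_antidiag_welded {R : Type*} [CommRing R] {n i : ℕ} (hi : i + 2 < n)
    (u v s t : R) :
    locMat n i !![0, s; t, 0] * locMat n (i + 1) !![0, u; v, 0] *
        locMat n i !![0, u; v, 0] =
      locMat n (i + 1) !![0, u; v, 0] * locMat n i !![0, u; v, 0] *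
        locMat n (i + 1) !![0, s; t, 0] := by
  have hi' : i + 1 < n := by lia
  have hj : i + 1 + 1 < n := hi
  ext a c
  simp only [Matrix.mul_assoc, locMat_mul_apply hi', locMat_mul_apply hj]
  by_cases h₀ : (a : ℕ) = i
  · simp [h₀, locMat]
    grind
  by_cases h₁ : (a : ℕ) = i + 1
  · simp [h₁, locMat]
    grind
  by_cases h₂ : (a : ℕ) = i + 1 + 1
  · simp [h₂, locMat]
    grind
  · simp [h₀, h₁, h₂, locMat]

/-- Fix `n >= 3` and nonzero `b, x : ℂ`, and let
`L_i = diag(I_(i-1), [[0,b],[1/b,0]], I_(n-i-1))`,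
`R_i = diag(I_(i-1), [[0,x],[1/x,0]], I_(n-i-1))`. Then the welded relation
`R_i L_(i+1) L_i = L_(i+1) L_i R_(i+1)` holds (so the representation `omega_1` of
`VL_n` induces a representation of `WL_n`). In contrast, if instead `L_i = I_n` for all
`i` (the representation `omega_2`), the welded relation fails:
`R_1 L_2 L_1 ≠ L_2 L_1 R_2`. -/
theorem welded_relation_omega (n : ℕ) (hn : 3 ≤ n) (b x : ℂ)
    (hb : b ≠ 0) (hx : x ≠ 0) :
    (∀ i j : Fin (n - 1), (i : ℕ) + 1 = (j : ℕ) →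
      locMat n (i : ℕ) !![0, x; 1 / x, 0] * locMat n (j : ℕ) !![0, b; 1 / b, 0] *
        locMat n (i : ℕ) !![0, b; 1 / b, 0] =
      locMat n (j : ℕ) !![0, b; 1 / b, 0] * locMat n (i : ℕ) !![0, b; 1 / b, 0] *
        locMat n (j : ℕ) !![0, x; 1 / x, 0]) ∧
    locMat n 0 !![0, x; 1 / x, 0] * (1 : Matrix (Fin n) (Fin n) ℂ) *
        (1 : Matrix (Fin n) (Fin n) ℂ) ≠
      (1 : Matrix (Fin n) (Fin n) ℂ) * (1 : Matrix (Fin n) (Fin n) ℂ) *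
        locMat n 1 !![0, x; 1 / x, 0] := by
  refine ⟨fun i j hij => ?_, fun h => ?_⟩
  · rw [← hij]
    exact locMat_antidiag_welded (by lia) _ _ _ _
  · have h₀₀ := congrFun (congrFun h ⟨0, by lia⟩) ⟨0, by lia⟩
    simp [locMat] at h₀₀
end

section
/- Fix n ≥ 3 and b, x ∈ ℂ*. For 1 ≤ i ≤ n-1 set L_i = diag(I_{i-1}, [[0,b],[1/b,0]], I_{n-i-1}) and R_i = diag(I_{i-1}, [[0,x],[1/x,0]], I_{n-i-1}) in GL_n(ℂ). Then the family {L_1,…,L_{n-1}, R_1,…,R_{n-1}} acts irreducibly on ℂ^n (i.e. every linear subspace U ⊆ ℂ^n with L_i(U) ⊆ U and R_i(U) ⊆ U for all 1 ≤ i ≤ n-1 is either {0} or ℂ^n) if and only if b ≠ x. In particular the representation ω₁ of VL_n is irreducible if and only if b ≠ x. -/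
/-- The defining relations of the virtual triplet group `VL_n`: generators
`l_i = Sum.inl i` and `rho_i = Sum.inr i` for `i : Fin (n-1)` (0-based), with the
triplet relations on the `l_i`, together with `rho_i ^ 2 = 1`,
`rho_i rho_j = rho_j rho_i` for `|i-j| >= 2`,
`rho_i rho_{i+1} rho_i = rho_{i+1} rho_i rho_{i+1}`, `l_i rho_j = rho_j l_i` for
`|i-j| >= 2`, and `rho_i rho_{i+1} l_i = l_{i+1} rho_i rho_{i+1}`. -/
def vtripletRels (n : ℕ) : Set (FreeGroup (Fin (n - 1) ⊕ Fin (n - 1))) :=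
  {r | (∃ i : Fin (n - 1), r = FreeGroup.of (.inl i) * FreeGroup.of (.inl i)) ∨
    (∃ i j : Fin (n - 1), (i : ℕ) + 1 = (j : ℕ) ∧
      r = FreeGroup.of (.inl i) * FreeGroup.of (.inl j) * FreeGroup.of (.inl i) *
          (FreeGroup.of (.inl j) * FreeGroup.of (.inl i) * FreeGroup.of (.inl j))⁻¹) ∨
    (∃ i : Fin (n - 1), r = FreeGroup.of (.inr i) * FreeGroup.of (.inr i)) ∨
    (∃ i j : Fin (n - 1), ((i : ℕ) + 2 ≤ (j : ℕ) ∨ (j : ℕ) + 2 ≤ (i : ℕ)) ∧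
      r = FreeGroup.of (.inr i) * FreeGroup.of (.inr j) *
          (FreeGroup.of (.inr j) * FreeGroup.of (.inr i))⁻¹) ∨
    (∃ i j : Fin (n - 1), (i : ℕ) + 1 = (j : ℕ) ∧
      r = FreeGroup.of (.inr i) * FreeGroup.of (.inr j) * FreeGroup.of (.inr i) *
          (FreeGroup.of (.inr j) * FreeGroup.of (.inr i) * FreeGroup.of (.inr j))⁻¹) ∨
    (∃ i j : Fin (n - 1), ((i : ℕ) + 2 ≤ (j : ℕ) ∨ (j : ℕ) + 2 ≤ (i : ℕ)) ∧
      r = FreeGroup.of (.inl i) * FreeGroup.of (.inr j) *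
          (FreeGroup.of (.inr j) * FreeGroup.of (.inl i))⁻¹) ∨
    (∃ i j : Fin (n - 1), (i : ℕ) + 1 = (j : ℕ) ∧
      r = FreeGroup.of (.inr i) * FreeGroup.of (.inr j) * FreeGroup.of (.inl i) *
          (FreeGroup.of (.inl j) * FreeGroup.of (.inr i) * FreeGroup.of (.inr j))⁻¹)}

/-- The virtual triplet group `VL_n`. -/
abbrev VTripletGroup (n : ℕ) := PresentedGroup (vtripletRels n)

/-- The generator `l_{i+1}` of `VL_n`. -/
def ellV {n : ℕ} (i : Fin (n - 1)) : VTripletGroup n := PresentedGroup.of (Sum.inl i)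

/-- The generator `rho_{i+1}` of `VL_n`. -/
def rhoV {n : ℕ} (i : Fin (n - 1)) : VTripletGroup n := PresentedGroup.of (Sum.inr i)

/-- The defining relations of the welded triplet group `WL_n`: those of `VL_n` together
with the welded relations `rho_i l_{i+1} l_i = l_{i+1} l_i rho_{i+1}`. -/
def wtripletRels (n : ℕ) : Set (FreeGroup (Fin (n - 1) ⊕ Fin (n - 1))) :=
  vtripletRels n ∪
    {r | ∃ i j : Fin (n - 1), (i : ℕ) + 1 = (j : ℕ) ∧
      r = FreeGroup.of (.inr i) * FreeGroup.of (.inl j) * FreeGroup.of (.inl i) *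
          (FreeGroup.of (.inl j) * FreeGroup.of (.inl i) * FreeGroup.of (.inr j))⁻¹}

/-- The welded triplet group `WL_n`. -/
abbrev WTripletGroup (n : ℕ) := PresentedGroup (wtripletRels n)

/-- The generator `l_{i+1}` of `WL_n`. -/
def ellW {n : ℕ} (i : Fin (n - 1)) : WTripletGroup n := PresentedGroup.of (Sum.inl i)

/-- The generator `rho_{i+1}` of `WL_n`. -/
def rhoW {n : ℕ} (i : Fin (n - 1)) : WTripletGroup n := PresentedGroup.of (Sum.inr i)

theorem locMat_antidiag_mulVec {R : Type*} [CommRing R] {n i : ℕ} (h : i + 1 < n) (p q : R)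
    (v : Fin n → R) (a : Fin n) :
    (locMat n i !![0, p; q, 0]).mulVec v a =
      if (a : ℕ) = i then p * v ⟨i + 1, h⟩
      else if (a : ℕ) = i + 1 then q * v ⟨i, by omega⟩
      else v a := by
  simp only [Matrix.mulVec, dotProduct]
  split_ifs with h1 h2
  · rw [Finset.sum_eq_single ⟨i + 1, h⟩]
    · simp [locMat, h1]
    · intro c _ hc
      have : (c : ℕ) ≠ i + 1 := fun e => hc (Fin.ext e)
      by_cases hi : (c : ℕ) = i
      · simp [locMat, h1, hi]
      · have hi' : i ≠ (c : ℕ) := fun e => hi e.symm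
        simp [locMat, h1, this, hi, hi']
    · simp
  · rw [Finset.sum_eq_single ⟨i, by omega⟩]
    · simp [locMat, h2]
    · intro c _ hc
      have : (c : ℕ) ≠ i := fun e => hc (Fin.ext e)
      by_cases hi : (c : ℕ) = i + 1
      · simp [locMat, h2, hi]
      · have hi' : i + 1 ≠ (c : ℕ) := fun e => hi e.symm
        simp [locMat, h2, this, hi, hi']
    · simp
  · rw [Finset.sum_eq_single a]
    · simp [locMat, h1, h2]
    · intro c _ hc
      have : (a : ℕ) ≠ c := fun e => hc (Fin.ext e.symm)
      simp [locMat, h1, h2, this]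
    · simp

theorem locMat_antidiag_mulVec_single_left {R : Type*} [CommRing R] {n i : ℕ} (h : i + 1 < n)
    (p q : R) :
    (locMat n i !![0, p; q, 0]).mulVec (Pi.single ⟨i, by omega⟩ 1) =
      q • Pi.single ⟨i + 1, h⟩ 1 := by
  ext a
  rw [locMat_antidiag_mulVec h]
  simp only [Pi.smul_apply, Pi.single_apply, Fin.ext_iff, smul_eq_mul]
  grind

theorem locMat_antidiag_mulVec_single_right {R : Type*} [CommRing R] {n i : ℕ} (h : i + 1 < n)
    (p q : R) :
    (locMat n i !![0, p; q, 0]).mulVec (Pi.single ⟨i + 1, h⟩ 1) =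
      p • Pi.single ⟨i, by omega⟩ 1 := by
  ext a
  rw [locMat_antidiag_mulVec h]
  simp only [Pi.smul_apply, Pi.single_apply, Fin.ext_iff, smul_eq_mul]
  grind

section Field

variable {K : Type*} [Field K] {n : ℕ}

/-- An invariant subspace containing one standard basis vector is everything. -/
theorem eq_top_of_single_mem {b : K} (hb : b ≠ 0) {U : Submodule K (Fin n → K)}
    (hU : ∀ i : Fin (n - 1), ∀ v ∈ U, (locMat n (i : ℕ) !![0, b; 1 / b, 0]).mulVec v ∈ U)
    {k : Fin n} (hk : Pi.single k 1 ∈ U) : U = ⊤ := by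
  have step (i : ℕ) (h : i + 1 < n) :
      (Pi.single ⟨i, by omega⟩ 1 : Fin n → K) ∈ U ↔
        (Pi.single ⟨i + 1, h⟩ 1 : Fin n → K) ∈ U := by
    constructor
    · intro hm
      have := hU ⟨i, by omega⟩ _ hm
      rw [locMat_antidiag_mulVec_single_left h] at this
      exact (U.smul_mem_iff (one_div_ne_zero hb)).1 this
    · intro hm
      have := hU ⟨i, by omega⟩ _ hm
      rw [locMat_antidiag_mulVec_single_right h] at this
      exact (U.smul_mem_iff hb).1 this
  have key (i : ℕ) (h : i < n) :
      (Pi.single ⟨i, h⟩ 1 : Fin n → K) ∈ U ↔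
        (Pi.single ⟨0, by omega⟩ 1 : Fin n → K) ∈ U := by
    induction i with
    | zero => rfl
    | succ i ih => rw [← step i h, ih]
  have all (i : Fin n) : (Pi.single i 1 : Fin n → K) ∈ U :=
    (key i i.2).2 ((key k k.2).1 hk)
  rw [eq_top_iff, ← (Pi.basisFun K (Fin n)).span_eq, Submodule.span_le]
  rintro _ ⟨i, rfl⟩
  simpa using all i

theorem exists_mem_apply_zero_ne_zero {b : K} (hb : b ≠ 0) {U : Submodule K (Fin n → K)}
    (hU : ∀ i : Fin (n - 1), ∀ v ∈ U, (locMat n (i : ℕ) !![0, b; 1 / b, 0]).mulVec v ∈ U)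
    (k : ℕ) (hk : k < n) (v : Fin n → K) (hv : v ∈ U) (hvk : v ⟨k, hk⟩ ≠ 0) :
    ∃ w ∈ U, w ⟨0, by omega⟩ ≠ 0 := by
  induction k generalizing v with
  | zero => exact ⟨v, hv, hvk⟩
  | succ k ih =>
    refine ih (by omega) _ (hU ⟨k, by omega⟩ v hv) ?_
    rw [locMat_antidiag_mulVec hk]
    simpa using ⟨hb, hvk⟩

theorem eq_bot_or_eq_top_of_invariant (hn : 3 ≤ n) {b x : K} (hb : b ≠ 0) (hbx : b ≠ x)
    {U : Submodule K (Fin n → K)}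
    (hL : ∀ i : Fin (n - 1), ∀ v ∈ U, (locMat n (i : ℕ) !![0, b; 1 / b, 0]).mulVec v ∈ U)
    (hR : ∀ i : Fin (n - 1), ∀ v ∈ U, (locMat n (i : ℕ) !![0, x; 1 / x, 0]).mulVec v ∈ U) :
    U = ⊥ ∨ U = ⊤ := by
  refine or_iff_not_imp_left.2 fun hne => ?_
  obtain ⟨v, hv, hv0⟩ := U.ne_bot_iff.1 hne
  obtain ⟨k, hk⟩ := Function.ne_iff.1 hv0
  obtain ⟨w, hw, hw0⟩ := exists_mem_apply_zero_ne_zero hb hL k k.2 v hv hk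
  have hD (i : Fin (n - 1)) (u : Fin n → K) (hu : u ∈ U) :=
    U.sub_mem (hL i u hu) (hR i u hu)
  have h2 := hD ⟨1, by omega⟩ _ (hD ⟨0, by omega⟩ w hw)
  set c : K := (1 / b - 1 / x) ^ 2 * w ⟨0, by omega⟩ with hc
  have hc0 : c ≠ 0 :=
    mul_ne_zero (pow_ne_zero _ (sub_ne_zero.2 fun h => hbx (by simpa using h))) hw0
  refine eq_top_of_single_mem hb hL (k := ⟨2, by omega⟩) ((U.smul_mem_iff hc0).1 ?_)
  convert h2 using 1
  ext a
  simp only [Pi.smul_apply, Pi.sub_apply, Pi.single_apply, Fin.ext_iff, smul_eq_mul,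
    locMat_antidiag_mulVec (show 0 + 1 < n by omega),
    locMat_antidiag_mulVec (show 1 + 1 < n by omega)]
  grind

theorem geometric_fixed {b : K} (hb : b ≠ 0) {i : ℕ} (h : i + 1 < n) :
    (locMat n i !![0, b; 1 / b, 0]).mulVec (fun a : Fin n => b⁻¹ ^ (a : ℕ)) =
      fun a : Fin n => b⁻¹ ^ (a : ℕ) := by
  ext a
  rw [locMat_antidiag_mulVec h]
  split_ifs with h1 h2
  · rw [h1, pow_succ]
    field_simp
  · rw [h2, pow_succ]
    field_simp
  · rfl

theorem exists_invariant_ne_bot_ne_top (hn : 2 ≤ n) {b : K} (hb : b ≠ 0) :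
    ∃ U : Submodule K (Fin n → K),
      (∀ i : Fin (n - 1), ∀ v ∈ U, (locMat n (i : ℕ) !![0, b; 1 / b, 0]).mulVec v ∈ U) ∧
        U ≠ ⊥ ∧ U ≠ ⊤ := by
  refine ⟨K ∙ (fun a : Fin n => b⁻¹ ^ (a : ℕ)), ?_, ?_, ?_⟩
  · intro i v hv
    obtain ⟨c, rfl⟩ := Submodule.mem_span_singleton.1 hv
    rw [Matrix.mulVec_smul, geometric_fixed hb (by omega)]
    exact hv
  · rw [Ne, Submodule.span_singleton_eq_bot]
    intro h
    simpa using congrFun h ⟨0, by omega⟩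
  · intro h
    have hm : (Pi.single ⟨0, by omega⟩ 1 : Fin n → K) ∈
        K ∙ (fun a : Fin n => b⁻¹ ^ (a : ℕ)) := h ▸ Submodule.mem_top
    obtain ⟨c, hc⟩ := Submodule.mem_span_singleton.1 hm
    have h0 := congrFun hc ⟨0, by omega⟩
    have h1 := congrFun hc ⟨1, by omega⟩
    simp [hb] at h0 h1
    simp [h1] at h0

end Field

theorem irreducible_family_iff {K : Type*} [Field K] {n : ℕ} (hn : 3 ≤ n) {b : K} (x : K)
    (hb : b ≠ 0) :
    (∀ U : Submodule K (Fin n → K),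
        (∀ i : Fin (n - 1), ∀ v ∈ U,
          (locMat n (i : ℕ) !![0, b; 1 / b, 0]).mulVec v ∈ U) →
        (∀ i : Fin (n - 1), ∀ v ∈ U,
          (locMat n (i : ℕ) !![0, x; 1 / x, 0]).mulVec v ∈ U) →
        U = ⊥ ∨ U = ⊤) ↔ b ≠ x := by
  refine ⟨?_, fun hbx U hL hR => eq_bot_or_eq_top_of_invariant hn hb hbx hL hR⟩
  rintro h rfl
  obtain ⟨U, hU, hbot, htop⟩ := exists_invariant_ne_bot_ne_top (n := n) (by omega) hb
  exact (h U hU hU).elim hbot htop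

theorem ellV_inv {n : ℕ} (i : Fin (n - 1)) : (ellV i)⁻¹ = ellV i :=
  inv_eq_of_mul_eq_one_right (PresentedGroup.one_of_mem (rels := vtripletRels n)
    (Or.inl ⟨i, rfl⟩))

theorem rhoV_inv {n : ℕ} (i : Fin (n - 1)) : (rhoV i)⁻¹ = rhoV i :=
  inv_eq_of_mul_eq_one_right (PresentedGroup.one_of_mem (rels := vtripletRels n)
    (Or.inr (Or.inr (Or.inl ⟨i, rfl⟩))))

/-- A subspace is invariant under `VL_n` as soon as it is invariant under the generators. -/
theorem VTripletGroup.invariant_of_generators {R : Type*} [CommRing R] {n m : ℕ}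
    (ω : VTripletGroup n →* Matrix.GeneralLinearGroup (Fin m) R)
    {U : Submodule R (Fin m → R)}
    (hl : ∀ i : Fin (n - 1), ∀ v ∈ U, (Units.val (ω (ellV i))).mulVec v ∈ U)
    (hr : ∀ i : Fin (n - 1), ∀ v ∈ U, (Units.val (ω (rhoV i))).mulVec v ∈ U)
    (g : VTripletGroup n) : ∀ v ∈ U, (Units.val (ω g)).mulVec v ∈ U := by
  induction g using PresentedGroup.induction_on with
  | _ z =>
    induction z using FreeGroup.induction_on with
    | C1 => intro v hv; simpa using hv
    | of j =>
      rcases j with i | i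
      · exact hl i
      · exact hr i
    | inv_of j _ =>
      rcases j with i | i
      · have := hl i
        rw [← ellV_inv] at this
        exact this
      · have := hr i
        rw [← rhoV_inv] at this
        exact this
    | mul y z hy hz =>
      intro v hv
      rw [map_mul, map_mul, Units.val_mul, ← Matrix.mulVec_mulVec]
      exact hy _ (hz v hv)

/-- Fix `n >= 3` and nonzero `b, x : ℂ`, and let
`L_i = diag(I_(i-1), [[0,b],[1/b,0]], I_(n-i-1))`,
`R_i = diag(I_(i-1), [[0,x],[1/x,0]], I_(n-i-1))`. The family of all `L_i` and `R_i`
acts irreducibly on `ℂ^n` (every subspace invariant under all of them is trivial or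
everything) if and only if `b ≠ x`; in particular, the representation
`omega_1 : VL_n → GL_n(ℂ)` with `omega_1 (l_i) = L_i`, `omega_1 (rho_i) = R_i` is
irreducible if and only if `b ≠ x`. -/
theorem omega1_irreducible_iff (n : ℕ) (hn : 3 ≤ n) (b x : ℂ)
    (hb : b ≠ 0) (hx : x ≠ 0) :
    ((∀ U : Submodule ℂ (Fin n → ℂ),
        (∀ i : Fin (n - 1), ∀ v ∈ U,
          (locMat n (i : ℕ) !![0, b; 1 / b, 0]).mulVec v ∈ U) →
        (∀ i : Fin (n - 1), ∀ v ∈ U,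
          (locMat n (i : ℕ) !![0, x; 1 / x, 0]).mulVec v ∈ U) →
        U = ⊥ ∨ U = ⊤) ↔ b ≠ x) ∧
    ∀ ω : VTripletGroup n →* Matrix.GeneralLinearGroup (Fin n) ℂ,
      (∀ i : Fin (n - 1),
        Units.val (ω (ellV i)) = locMat n (i : ℕ) !![0, b; 1 / b, 0]) →
      (∀ i : Fin (n - 1),
        Units.val (ω (rhoV i)) = locMat n (i : ℕ) !![0, x; 1 / x, 0]) →
      ((∀ U : Submodule ℂ (Fin n → ℂ),
          (∀ g : VTripletGroup n, ∀ v ∈ U, (Units.val (ω g)).mulVec v ∈ U) →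
          U = ⊥ ∨ U = ⊤) ↔ b ≠ x) := by
  refine ⟨irreducible_family_iff hn x hb, fun ω hl hr => ?_⟩
  rw [← irreducible_family_iff hn x hb]
  refine forall_congr' fun U => ⟨fun h hL hR => h ?_, fun h hU => h ?_ ?_⟩
  · exact VTripletGroup.invariant_of_generators ω (fun i => by rw [hl i]; exact hL i)
      (fun i => by rw [hr i]; exact hR i)
  · exact fun i => by rw [← hl i]; exact hU _
  · exact fun i => by rw [← hr i]; exact hU _
end
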